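/- Consider a path graph with n nodes and m = n−1 edges and a transaction matrix T. Then the maximum profit over all fee assignments f ∈ [0,1]^m equals −m plus the maximum over all subsets A ⊆ {1,…,m} of Σ_{1 ≤ i < j ≤ n} T[i,j] · 𝟙[ |A ∩ {i, i+1, …, j−1}| = 1 ]. In other words, maximizing the profit over continuous fee vectors in [0,1]^m reduces to choosing the set A of edges that receive fee 1 so as to maximize the total weight of transaction pairs whose path contains exactly one edge of A. -/

import Mathlib

/-- Total fee of the path from node `i` to node `j` (`i < j`) in the path graph,
using edges `i, i+1, …, j-1`. -/
def pathFee (f : ℕ → ℝ) (i j : ℕ) : ℝ := ∑ k ∈ Finset.Icc i (j - 1), f k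

/-- Profit of the path graph on `n` nodes (edges `1,…,n-1`) with transaction
matrix `T` and fee assignment `f`. -/
noncomputable def pathProfit (n : ℕ) (T : ℕ → ℕ → ℕ) (f : ℕ → ℝ) : ℝ :=
  -((n - 1 : ℕ) : ℝ) +
    ∑ p ∈ (Finset.Icc 1 n ×ˢ Finset.Icc 1 n).filter (fun p => p.1 < p.2),
      (T p.1 p.2 : ℝ) * (if pathFee f p.1 p.2 ≤ 1 then pathFee f p.1 p.2 else 0)

/-- Total weight of transaction pairs whose path contains exactly one edge of
the set `A` (the edges receiving fee `1`). -/
def cutWeight (n : ℕ) (T : ℕ → ℕ → ℕ) (A : Finset ℕ) : ℕ :=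
  ∑ p ∈ (Finset.Icc 1 n ×ˢ Finset.Icc 1 n).filter (fun p => p.1 < p.2),
    if (A ∩ Finset.Icc p.1 (p.2 - 1)).card = 1 then T p.1 p.2 else 0

theorem intervalIntegrable_floor_add (y : ℝ) :
    IntervalIntegrable (fun u : ℝ => (⌊y + u⌋ : ℝ)) MeasureTheory.volume 0 1 :=
  Monotone.intervalIntegrable fun a b hab => by
    exact_mod_cast Int.floor_mono (by linarith : y + a ≤ y + b)

open MeasureTheory in
/-- The average of `⌊x + u⌋` over `u ∈ [0, 1]` is `x`. -/
theorem integral_floor_add (x : ℝ) : ∫ u in (0 : ℝ)..1, (⌊x + u⌋ : ℝ) = x := by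
  have hper : ∫ u in (0 : ℝ)..1, Int.fract (x + u) = ∫ u in (0 : ℝ)..1, Int.fract u := by
    have hp : Function.Periodic (Int.fract : ℝ → ℝ) 1 := fun y => Int.fract_add_one y
    have h := hp.intervalIntegral_add_eq x 0
    rw [intervalIntegral.integral_comp_add_left (fun u : ℝ => Int.fract u) x]
    simpa using h
  have hfract : ∀ y : ℝ, ∫ u in (0 : ℝ)..1, Int.fract (y + u)
      = y + 1 / 2 - ∫ u in (0 : ℝ)..1, (⌊y + u⌋ : ℝ) := by
    intro y
    have hlin : ∫ u in (0 : ℝ)..1, (y + u) = y + 1 / 2 := by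
      rw [intervalIntegral.integral_add (by simp) (by simp)]
      simp
    rw [← hlin, ← intervalIntegral.integral_sub (by
      exact (continuous_const.add continuous_id).intervalIntegrable _ _) (intervalIntegrable_floor_add y)]
    rfl
  have hzero : ∫ u in (0 : ℝ)..1, (⌊u⌋ : ℝ) = 0 := by
    have h : ∫ u in (0 : ℝ)..1, (⌊u⌋ : ℝ) = ∫ _u in (0 : ℝ)..1, (0 : ℝ) := by
      apply intervalIntegral.integral_congr_ae
      filter_upwards [Measure.ae_ne volume (1 : ℝ)] with u hu1 hu
      rw [Set.uIoc_of_le zero_le_one] at hu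
      have : ⌊u⌋ = 0 := Int.floor_eq_zero_iff.2 ⟨hu.1.le, lt_of_le_of_ne hu.2 hu1⟩
      simp [this]
    simpa using h
  have h0 := hfract 0
  simp only [zero_add, hzero] at h0
  linarith [hfract x]

/-- Edges at which the prefix sums of `f`, shifted by `u`, step over an integer. -/
noncomputable def crossingEdges (n : ℕ) (f : ℕ → ℝ) (u : ℝ) : Finset ℕ :=
  (Finset.Icc 1 (n - 1)).filter fun k =>
    ⌊∑ l ∈ Finset.range k, f l + u⌋ < ⌊∑ l ∈ Finset.range (k + 1), f l + u⌋

theorem Icc_pred_eq_Ico {i j : ℕ} (hij : i < j) : Finset.Icc i (j - 1) = Finset.Ico i j := by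
  ext k
  simp only [Finset.mem_Icc, Finset.mem_Ico]
  omega

theorem pathFee_eq_sub (f : ℕ → ℝ) {i j : ℕ} (hij : i < j) :
    pathFee f i j = ∑ l ∈ Finset.range j, f l - ∑ l ∈ Finset.range i, f l := by
  rw [pathFee, Icc_pred_eq_Ico hij, Finset.sum_Ico_eq_sub _ hij.le]

/-- The number of crossing edges on a path is the increment of the integer part. -/
theorem card_crossingEdges_inter {n : ℕ} {f : ℕ → ℝ}
    (hf : ∀ k ∈ Finset.Icc 1 (n - 1), 0 ≤ f k ∧ f k ≤ 1) (u : ℝ) {i j : ℕ}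
    (hi : 1 ≤ i) (hij : i < j) (hj : j ≤ n) :
    ((crossingEdges n f u ∩ Finset.Icc i (j - 1)).card : ℤ)
      = ⌊∑ l ∈ Finset.range j, f l + u⌋ - ⌊∑ l ∈ Finset.range i, f l + u⌋ := by
  set g : ℕ → ℤ := fun k => ⌊∑ l ∈ Finset.range k, f l + u⌋ with hg
  have hstep : ∀ k ∈ Finset.Ico i j,
      (if k ∈ crossingEdges n f u then (1 : ℤ) else 0) = g (k + 1) - g k := by
    intro k hk
    rw [Finset.mem_Ico] at hk
    have hkn : k ∈ Finset.Icc 1 (n - 1) := Finset.mem_Icc.2 (by omega)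
    obtain ⟨h0, h1⟩ := hf k hkn
    have hsucc : ∑ l ∈ Finset.range (k + 1), f l = ∑ l ∈ Finset.range k, f l + f k :=
      Finset.sum_range_succ _ _
    have hle : g k ≤ g (k + 1) := Int.floor_mono (by linarith)
    have hge : g (k + 1) ≤ g k + 1 := by
      rw [hg]
      simp only
      rw [← Int.floor_add_one]
      exact Int.floor_mono (by linarith)
    have hmem : k ∈ crossingEdges n f u ↔ g k < g (k + 1) := by
      simp only [crossingEdges, Finset.mem_filter, hkn, true_and, hg]
    simp only [hmem]
    split_ifs <;> omega
  rw [Icc_pred_eq_Ico hij, Finset.inter_comm, ← Finset.filter_mem_eq_inter, Finset.card_filter]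
  push_cast
  rw [Finset.sum_congr rfl hstep, Finset.sum_Ico_eq_sub _ hij.le, Finset.sum_range_sub,
    Finset.sum_range_sub]
  ring

/-- Rounding the fees with the shift `u` yields a cut at least as heavy as the rounded profit. -/
theorem sum_floor_sub_le_cutWeight {n : ℕ} (T : ℕ → ℕ → ℕ) {f : ℕ → ℝ}
    (hf : ∀ k ∈ Finset.Icc 1 (n - 1), 0 ≤ f k ∧ f k ≤ 1) (u : ℝ) :
    ∑ p ∈ (Finset.Icc 1 n ×ˢ Finset.Icc 1 n).filter (fun p => p.1 < p.2),
      (if pathFee f p.1 p.2 ≤ 1 then (T p.1 p.2 : ℝ) else 0) *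
        ((⌊∑ l ∈ Finset.range p.2, f l + u⌋ : ℝ) - ⌊∑ l ∈ Finset.range p.1, f l + u⌋)
      ≤ cutWeight n T (crossingEdges n f u) := by
  rw [cutWeight, Nat.cast_sum]
  refine Finset.sum_le_sum fun p hp => ?_
  simp only [Finset.mem_filter, Finset.mem_product, Finset.mem_Icc] at hp
  obtain ⟨⟨⟨hi, -⟩, -, hj⟩, hij⟩ := hp
  have hcard := card_crossingEdges_inter hf u hi hij hj
  have hcast : ((crossingEdges n f u ∩ Finset.Icc p.1 (p.2 - 1)).card : ℝ)
      = (⌊∑ l ∈ Finset.range p.2, f l + u⌋ : ℝ) - ⌊∑ l ∈ Finset.range p.1, f l + u⌋ := by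
    exact_mod_cast hcard
  rw [← hcast]
  by_cases hfee : pathFee f p.1 p.2 ≤ 1
  · have hle : (crossingEdges n f u ∩ Finset.Icc p.1 (p.2 - 1)).card ≤ 1 := by
      rw [pathFee_eq_sub f hij] at hfee
      have : ⌊∑ l ∈ Finset.range p.2, f l + u⌋ ≤ ⌊∑ l ∈ Finset.range p.1, f l + u⌋ + 1 := by
        rw [← Int.floor_add_one]
        exact Int.floor_mono (by linarith)
      omega
    rw [if_pos hfee]
    interval_cases (crossingEdges n f u ∩ Finset.Icc p.1 (p.2 - 1)).card <;> simp
  · rw [if_neg hfee, zero_mul]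
    exact Nat.cast_nonneg _

/-- The profit is bounded by the best cut, by averaging over all shifts. -/
theorem pathProfit_le_best_cut {n : ℕ} (T : ℕ → ℕ → ℕ) {f : ℕ → ℝ}
    (hf : ∀ k ∈ Finset.Icc 1 (n - 1), 0 ≤ f k ∧ f k ≤ 1) :
    pathProfit n T f ≤ -((n - 1 : ℕ) : ℝ) +
      ((Finset.Icc 1 (n - 1)).powerset.sup (cutWeight n T) : ℕ) := by
  have hterm : ∀ p ∈ (Finset.Icc 1 n ×ˢ Finset.Icc 1 n).filter (fun p => p.1 < p.2),
      IntervalIntegrable (fun u : ℝ => (if pathFee f p.1 p.2 ≤ 1 then (T p.1 p.2 : ℝ) else 0) *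
        ((⌊∑ l ∈ Finset.range p.2, f l + u⌋ : ℝ) - ⌊∑ l ∈ Finset.range p.1, f l + u⌋))
        MeasureTheory.volume 0 1 :=
    fun p _ => ((intervalIntegrable_floor_add _).sub
      (intervalIntegrable_floor_add _)).const_mul _
  have hmono := intervalIntegral.integral_mono_on (zero_le_one' ℝ)
    (by simpa only [Finset.sum_fn] using IntervalIntegrable.sum _ hterm)
    (intervalIntegrable_const (μ := MeasureTheory.volume)
      (c := (((Finset.Icc 1 (n - 1)).powerset.sup (cutWeight n T) : ℕ) : ℝ)))
    fun u _ => (sum_floor_sub_le_cutWeight T hf u).trans <| Nat.cast_le.2 <|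
      Finset.le_sup (Finset.mem_powerset.2 (Finset.filter_subset _ _))
  rw [intervalIntegral.integral_finsetSum hterm] at hmono
  simp only [intervalIntegral.integral_const, sub_zero, one_smul] at hmono
  refine add_le_add le_rfl (le_of_eq_of_le (Finset.sum_congr rfl fun p hp => ?_) hmono)
  rw [intervalIntegral.integral_const_mul, intervalIntegral.integral_sub
    (intervalIntegrable_floor_add _) (intervalIntegrable_floor_add _),
    integral_floor_add, integral_floor_add, ← pathFee_eq_sub f (Finset.mem_filter.1 hp).2]
  split_ifs <;> simp

/-- Charging fee `1` exactly on `A` realizes the weight of the cut `A`. -/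
theorem pathProfit_indicator (n : ℕ) (T : ℕ → ℕ → ℕ) (A : Finset ℕ) :
    pathProfit n T (fun k => if k ∈ A then 1 else 0)
      = -((n - 1 : ℕ) : ℝ) + (cutWeight n T A : ℕ) := by
  rw [pathProfit, cutWeight, Nat.cast_sum]
  congr 1
  refine Finset.sum_congr rfl fun p _ => ?_
  have hfee : pathFee (fun k => if k ∈ A then 1 else 0) p.1 p.2
      = ((A ∩ Finset.Icc p.1 (p.2 - 1)).card : ℝ) := by
    rw [pathFee, Finset.inter_comm, ← Finset.filter_mem_eq_inter, Finset.card_filter]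
    push_cast
    rfl
  rw [hfee]
  generalize (A ∩ Finset.Icc p.1 (p.2 - 1)).card = c
  rcases c with _ | _ | c
  · simp
  · simp
  · have : ¬ ((c + 1 + 1 : ℕ) : ℝ) ≤ 1 := by
      exact_mod_cast (by omega : ¬ c + 1 + 1 ≤ 1)
    rw [if_neg this]
    simp

/-- The maximum profit on a path graph over all fee assignments in `[0,1]^m`
equals `-m` plus the maximum over subsets `A` of the edges of the total weight
of transaction pairs whose path contains exactly one edge of `A`. -/
theorem pathProfit_max_eq_best_cut (n : ℕ) (hn : 2 ≤ n)
    (T : ℕ → ℕ → ℕ) (hsymm : ∀ i j, T i j = T j i) (hdiag : ∀ i, T i i = 0) :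
    IsGreatest
      {x : ℝ | ∃ f : ℕ → ℝ,
        (∀ k ∈ Finset.Icc 1 (n - 1), 0 ≤ f k ∧ f k ≤ 1) ∧ x = pathProfit n T f}
      (-((n - 1 : ℕ) : ℝ) +
        ((Finset.Icc 1 (n - 1)).powerset.sup (cutWeight n T) : ℕ)) := by
  constructor
  · obtain ⟨A, -, hA⟩ := Finset.exists_mem_eq_sup (Finset.Icc 1 (n - 1)).powerset
      ⟨∅, Finset.empty_mem_powerset _⟩ (cutWeight n T)
    refine ⟨fun k => if k ∈ A then 1 else 0, fun k _ => ?_, ?_⟩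
    · dsimp only
      split_ifs <;> norm_num
    · rw [hA, pathProfit_indicator]
  · rintro x ⟨f, hf, rfl⟩
    exact pathProfit_le_best_cut T hf
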